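/- Fix an integer n ≥ 1. Let S ⊂ ℝ^n be the half-open simplex of all β = (β_1, …, β_n) such that for some 0 ≤ N ≤ n one has β_1 > ⋯ > β_N > 0 and β_{N+1} = ⋯ = β_n = 0, let Φ : S → ℝ^n be given by Φ(β)_m = (−1)^{m+1}(2^{2m+1}/(2m+1)) Σ_{j=1}^{n} β_j^{2m+1}, and let 𝓜ⁿ_n = Φ(S). Define C : 𝓜ⁿ_n → ℝ by C(Φ(β)) = (−1)^n (2^{2n+3}/(2n+3)) Σ_{j=1}^{n} β_j^{2n+3} (well-defined since Φ is injective). Then: (i) C is continuous on 𝓜ⁿ_n; (ii) C is decreasing in each variable, i.e. if e, ẽ ∈ 𝓜ⁿ_n with ẽ_m ≤ e_m for every m, then C(ẽ) ≥ C(e); (iii) on the interior of 𝓜ⁿ_n (which corresponds to β_1 > ⋯ > β_n > 0), C is continuously differentiable and ∂C/∂e_j < 0 for every j = 1, …, n. -/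

import Mathlib

/-- The half-open simplex of multisoliton parameters: `β ∈ ℝⁿ` such that for some
`0 ≤ N ≤ n`, `β_1 > β_2 > ⋯ > β_N > 0` and `β_{N+1} = ⋯ = β_n = 0`. -/
def simplexS (n : ℕ) : Set (Fin n → ℝ) :=
  {β | ∃ N ≤ n, (∀ i : Fin n, (i : ℕ) < N → 0 < β i) ∧
    (∀ i j : Fin n, i < j → (j : ℕ) < N → β j < β i) ∧
    (∀ i : Fin n, N ≤ (i : ℕ) → β i = 0)}

/-- `Φ(β)_m = (-1)^{m+1} (2^{2m+1}/(2m+1)) ∑_j β_j^{2m+1}` for `m = 1, …, n`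
(here the index `m : Fin n` corresponds to the mathematical index `m + 1`). -/
noncomputable def PhiMap (n : ℕ) (β : Fin n → ℝ) : Fin n → ℝ :=
  fun m => (-1 : ℝ) ^ (m : ℕ) * 2 ^ (2 * (m : ℕ) + 3) / (2 * (m : ℕ) + 3 : ℝ) *
    ∑ j, β j ^ (2 * (m : ℕ) + 3)


/-- energy -/
noncomputable def EE (n m : ℕ) (β : Fin n → ℝ) : ℝ :=
  (-1 : ℝ) ^ m * 2 ^ (2 * m + 3) / (2 * m + 3 : ℝ) * ∑ j, β j ^ (2 * m + 3)

theorem poly_exp (r : ℕ → ℝ) (hr : ∀ i, 0 ≤ r i) (d : ℕ) :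
    ∃ a : ℕ → ℝ, (∀ m, 0 ≤ a m) ∧ ((∀ i < d, 0 < r i) → ∀ m ≤ d, 0 < a m) ∧
      a d = 1 ∧ (∀ m, d < m → a m = 0) ∧
      ∀ x : ℝ, ∏ i ∈ Finset.range d, (r i - x) = ∑ m ∈ Finset.range (d + 1), a m * (-x) ^ m := by
  induction d with
  | zero =>
    refine ⟨fun m => if m = 0 then 1 else 0, ?_, ?_, ?_, ?_, ?_⟩
    · intro m; dsimp; split_ifs <;> norm_num
    · intro _ m hm
      have : m = 0 := by omega
      simp [this]
    · simp
    · intro m hm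
      have : m ≠ 0 := by omega
      simp [this]
    · intro x; simp
  | succ d ih =>
    obtain ⟨a, h0, hpos, h1, hz, hx⟩ := ih
    refine ⟨fun m => r d * a m + (if m = 0 then 0 else a (m - 1)), ?_, ?_, ?_, ?_, ?_⟩
    · intro m
      have := mul_nonneg (hr d) (h0 m)
      dsimp; split_ifs
      · linarith
      · linarith [h0 (m - 1)]
    · intro hp m hm
      have hp' := hpos (fun i hi => hp i (by omega))
      have hrd := hp d (by omega)
      dsimp; split_ifs with h
      · have := mul_pos hrd (hp' m (by omega)); linarith
      · have := mul_nonneg hrd.le (h0 m)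
        linarith [hp' (m - 1) (by omega)]
    · simp [hz (d + 1) (by omega), h1]
    · intro m hm
      have : m ≠ 0 := by omega
      simp [this, hz m (by omega), hz (m - 1) (by omega)]
    · intro x
      rw [Finset.prod_range_succ, hx]
      simp only [add_mul, Finset.sum_add_distrib]
      rw [Finset.sum_range_succ (n := d + 1), hz (d + 1) (by omega),
        Finset.sum_range_succ' (n := d + 1)]
      simp only [Nat.add_sub_cancel, if_true, Nat.succ_ne_zero, if_false, pow_succ]
      simp only [Finset.sum_mul, mul_sub]
      simp only [← Finset.sum_sub_distrib, mul_zero, zero_mul, add_zero]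
      rw [← Finset.sum_add_distrib]
      refine Finset.sum_congr rfl fun m _ => ?_
      ring

/-- choice of the roots -/
theorem roots_exist (β γ : ℕ → ℝ) (hβ : Antitone β) (hγ : Antitone γ) (hβ0 : ∀ i, 0 ≤ β i)
    (hγ0 : ∀ i, 0 ≤ γ i) (d : ℕ) (hd : ∀ k, d ≤ k → β k ≤ γ k) :
    ∃ r : ℕ → ℝ, (∀ i, 0 ≤ r i) ∧ ∀ k,
      (β k ≤ γ k → ∀ t, β k ≤ t → t ≤ γ k → 0 ≤ ∏ i ∈ Finset.range d, (r i - t ^ 2)) ∧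
      (γ k ≤ β k → γ k < β k → ∀ t, γ k ≤ t → t ≤ β k → ∏ i ∈ Finset.range d, (r i - t ^ 2) ≤ 0) := by
  classical
  set s : ℕ → ℝ := fun k => if β k ≤ γ k then 1 else -1 with hs
  have hss : ∀ k, s k * s k = 1 := by intro k; simp only [hs]; split_ifs <;> norm_num
  set R : ℝ := max (β 0) (γ 0) with hR
  set r : ℕ → ℝ := fun i => if s i = s (i + 1) then R ^ 2 else (min (β i) (γ i)) ^ 2 with hr
  have hRt : ∀ k t, 0 ≤ t → t ≤ max (β k) (γ k) → 0 ≤ R ^ 2 - t ^ 2 := by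
    intro k t h0 ht
    have : t ≤ R := ht.trans (max_le_max (hβ (Nat.zero_le k)) (hγ (Nat.zero_le k)))
    nlinarith
  have key1 : ∀ k i t, k ≤ i → min (β k) (γ k) ≤ t → t ≤ max (β k) (γ k) →
      0 ≤ (s i * s (i + 1)) * (r i - t ^ 2) := by
    intro k i t hki h1 h2
    have h0 : 0 ≤ t := (le_min (hβ0 k) (hγ0 k)).trans h1
    by_cases h : s i = s (i + 1)
    · simp only [hr, ← h, if_true, hss, one_mul]
      exact hRt k t h0 h2
    · have hm : s i * s (i + 1) = -1 := by
        revert h; simp only [hs]; split_ifs <;> norm_num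
      simp only [hr, if_neg h, hm]
      have h3 : min (β i) (γ i) ≤ t := (min_le_min (hβ hki) (hγ hki)).trans h1
      have h4 : 0 ≤ min (β i) (γ i) := le_min (hβ0 i) (hγ0 i)
      nlinarith
  have key2 : ∀ k i t, i < k → min (β k) (γ k) ≤ t → t ≤ max (β k) (γ k) →
      0 ≤ r i - t ^ 2 := by
    intro k i t hki h1 h2
    have h0 : 0 ≤ t := (le_min (hβ0 k) (hγ0 k)).trans h1
    by_cases h : s i = s (i + 1)
    · simp only [hr, if_pos h]
      exact hRt k t h0 h2
    · simp only [hr, if_neg h]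
      have h3 : t ≤ max (β (i+1)) (γ (i+1)) := h2.trans (max_le_max (hβ hki) (hγ hki))
      have h4 : max (β (i+1)) (γ (i+1)) ≤ min (β i) (γ i) := by
        have a1 := hβ (Nat.le_succ i)
        have a2 := hγ (Nat.le_succ i)
        simp only [Nat.succ_eq_add_one] at a1 a2
        revert h
        simp only [hs]
        split_ifs with b1 b2 b2 <;> intro h
        · exact absurd rfl h
        · push Not at b2
          exact max_le (le_min a1 (a1.trans b1)) (le_min (b2.le.trans a1) a2)
        · push Not at b1
          exact max_le (le_min a1 (b2.trans a2)) (le_min (a2.trans b1.le) a2)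
        · exact absurd rfl h
      nlinarith
  have key : ∀ k t, min (β k) (γ k) ≤ t → t ≤ max (β k) (γ k) →
      0 ≤ s k * ∏ i ∈ Finset.range d, (r i - t ^ 2) := by
    intro k t h1 h2
    have hsd : ∀ k, d ≤ k → s k = 1 := fun k hk => if_pos (hd k hk)
    by_cases hkd : k ≤ d
    · have tel : ∀ e, k ≤ e → 0 ≤ s k * s e * ∏ i ∈ Finset.range e, (r i - t ^ 2) := by
        intro e he
        induction e, he using Nat.le_induction with
        | base =>
          rw [hss, one_mul]
          exact Finset.prod_nonneg fun i hi => key2 k i t (Finset.mem_range.1 hi) h1 h2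
        | succ e he ih =>
          rw [Finset.prod_range_succ]
          have := mul_nonneg ih (key1 k e t he h1 h2)
          have e1 : s k * s e * ∏ i ∈ Finset.range e, (r i - t ^ 2) = s k * s e * ∏ i ∈ Finset.range e, (r i - t ^ 2) := rfl
          have e2 : (s k * s e * ∏ i ∈ Finset.range e, (r i - t ^ 2)) * (s e * s (e + 1) * (r e - t ^ 2))
            = (s e * s e) * (s k * s (e + 1) * ((∏ i ∈ Finset.range e, (r i - t ^ 2)) * (r e - t ^ 2))) := by ring
          rw [e2, hss, one_mul] at this
          exact this
      have := tel d hkd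
      rwa [hsd d le_rfl, mul_one] at this
    · push Not at hkd
      rw [hsd k hkd.le, one_mul]
      exact Finset.prod_nonneg fun i hi => key2 k i t ((Finset.mem_range.1 hi).trans hkd) h1 h2
  refine ⟨r, ?_, fun k => ⟨?_, ?_⟩⟩
  · intro i; simp only [hr]; split_ifs <;> positivity
  · intro h t h1 h2
    have := key k t ((min_le_left _ _).trans h1) (h2.trans (le_max_right _ _))
    have e : s k = 1 := if_pos h
    rwa [e, one_mul] at this
  · intro _ h t h1 h2
    have := key k t ((min_le_right _ _).trans h1) (h2.trans (le_max_left _ _))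
    have e : s k = -1 := if_neg (not_le.2 h)
    rw [e] at this
    linarith

/-- derivative identity -/
theorem hasDeriv_H (a : ℕ → ℝ) (d : ℕ) (t : ℝ) :
    HasDerivAt (fun b : ℝ => ∑ m ∈ Finset.range (d + 1),
      a m * ((-1 : ℝ) ^ m * 2 ^ (2 * m + 3) / (2 * m + 3 : ℝ) * b ^ (2 * m + 3)))
      (8 * t ^ 2 * ∑ m ∈ Finset.range (d + 1), a m * (-(4 * t ^ 2)) ^ m) t := by
  rw [Finset.mul_sum]
  refine HasDerivAt.fun_sum fun m _ => ?_
  have h := ((hasDerivAt_pow (2 * m + 3) t).const_mul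
    ((-1 : ℝ) ^ m * 2 ^ (2 * m + 3) / (2 * m + 3 : ℝ))).const_mul (a m)
  refine h.congr_deriv ?_
  have h3 : (2 * (m : ℝ) + 3) ≠ 0 := by positivity
  have e1 : (2 : ℝ) ^ (2 * m + 3) = 8 * 4 ^ m := by
    rw [pow_add, pow_mul]; norm_num; ring
  have e2 : (-(4 * t ^ 2)) ^ m = (-1) ^ m * 4 ^ m * t ^ (2 * m) := by
    rw [neg_pow, mul_pow, ← pow_mul]; ring
  have e3 : 2 * m + 3 - 1 = 2 * m + 2 := by omega
  rw [e1, e2, e3]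
  push_cast
  field_simp
  ring

theorem main_lemma (n d : ℕ) (β γ : Fin n → ℝ) (hβ : Antitone β) (hγ : Antitone γ)
    (hβ0 : ∀ i, 0 ≤ β i) (hγ0 : ∀ i, 0 ≤ γ i) (hd : ∀ k : Fin n, d ≤ k → β k ≤ γ k) :
    ∃ a : ℕ → ℝ, (∀ m, 0 ≤ a m) ∧ a d = 1 ∧
      0 ≤ ∑ m ∈ Finset.range (d + 1), a m * (EE n m γ - EE n m β) := by
  set X : (Fin n → ℝ) → ℕ → ℝ := fun β i => if h : i < n then β ⟨i, h⟩ else 0 with hX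
  have hXa : ∀ β : Fin n → ℝ, Antitone β → (∀ i, 0 ≤ β i) → Antitone (X β) ∧ ∀ i, 0 ≤ X β i := by
    intro β h h0
    constructor
    · intro i j hij
      simp only [hX]
      split_ifs with h1 h2 h2
      · exact h (by simpa using hij)
      · omega
      · exact h0 _
      · exact le_rfl
    · intro i; simp only [hX]; split_ifs
      · exact h0 _
      · exact le_rfl
  obtain ⟨r, hr0, hr⟩ := roots_exist (X β) (X γ) (hXa β hβ hβ0).1 (hXa γ hγ hγ0).1
    (hXa β hβ hβ0).2 (hXa γ hγ hγ0).2 d (by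
      intro k hk
      simp only [hX]; split_ifs with h
      · exact hd _ hk
      · exact le_rfl)
  obtain ⟨a, ha0, -, had, -, hax⟩ := poly_exp (fun i => 4 * r i)
    (fun i => by have := hr0 i; positivity) d
  refine ⟨a, ha0, had, ?_⟩
  set H : ℝ → ℝ := fun b : ℝ => ∑ m ∈ Finset.range (d + 1),
      a m * ((-1 : ℝ) ^ m * 2 ^ (2 * m + 3) / (2 * m + 3 : ℝ) * b ^ (2 * m + 3)) with hH
  have hder : ∀ t, HasDerivAt H (8 * t ^ 2 * (4 ^ d * ∏ i ∈ Finset.range d, (r i - t ^ 2))) t := by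
    intro t
    refine (hasDeriv_H a d t).congr_deriv ?_
    rw [← hax]
    congr 1
    simp only [← mul_sub, Finset.prod_mul_distrib, Finset.prod_const, Finset.card_range]
  have hcont : Continuous H := continuous_iff_continuousAt.2 fun t => (hder t).continuousAt
  have hdiff : Differentiable ℝ H := fun t => (hder t).differentiableAt
  have hk : ∀ k : Fin n, H (β k) ≤ H (γ k) := by
    intro k
    have hrk := hr k
    have x1 : X β k = β k := by simp [hX]
    have x2 : X γ k = γ k := by simp [hX]
    rw [x1, x2] at hrk
    rcases le_or_gt (β k) (γ k) with h | h
    · refine monotoneOn_of_deriv_nonneg (convex_Icc (β k) (γ k)) hcont.continuousOn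
        hdiff.differentiableOn ?_ (Set.left_mem_Icc.2 h) (Set.right_mem_Icc.2 h) h
      intro t ht
      rw [interior_Icc] at ht
      rw [(hder t).deriv]
      have := hrk.1 h t ht.1.le ht.2.le
      positivity
    · refine antitoneOn_of_deriv_nonpos (convex_Icc (γ k) (β k)) hcont.continuousOn
        hdiff.differentiableOn ?_ (Set.left_mem_Icc.2 h.le) (Set.right_mem_Icc.2 h.le) h.le
      intro t ht
      rw [interior_Icc] at ht
      rw [(hder t).deriv]
      have := hrk.2 h.le h t ht.1.le ht.2.le
      refine mul_nonpos_of_nonneg_of_nonpos (by positivity) ?_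
      exact mul_nonpos_of_nonneg_of_nonpos (by positivity) this
  have hsum : ∀ β : Fin n → ℝ, ∑ k, H (β k) = ∑ m ∈ Finset.range (d + 1), a m * EE n m β := by
    intro β
    simp only [hH, EE]
    rw [Finset.sum_comm]
    simp only [Finset.mul_sum]
  simp only [mul_sub, Finset.sum_sub_distrib, ← hsum]
  exact sub_nonneg.2 (Finset.sum_le_sum fun k _ => hk k)

theorem simplex_sub (n : ℕ) (β : Fin n → ℝ) (h : β ∈ simplexS n) :
    Antitone β ∧ ∀ i, 0 ≤ β i := by
  obtain ⟨N, hN, h1, h2, h3⟩ := h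
  have h0 : ∀ i, 0 ≤ β i := by
    intro i
    by_cases hi : (i : ℕ) < N
    · exact (h1 i hi).le
    · exact (h3 i (by omega)).ge
  refine ⟨?_, h0⟩
  intro i j hij
  rcases hij.eq_or_lt with h | h
  · rw [h]
  · by_cases hj : (j : ℕ) < N
    · exact (h2 i j h hj).le
    · rw [h3 j (by omega)]; exact h0 i

theorem phi_eq (n : ℕ) (β : Fin n → ℝ) (m : Fin n) : PhiMap n β m = EE n m β := rfl

theorem EE_mono (n : ℕ) (β γ : Fin n → ℝ) (hβ : Antitone β) (hγ : Antitone γ)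
    (hβ0 : ∀ i, 0 ≤ β i) (hγ0 : ∀ i, 0 ≤ γ i) (h : ∀ m, PhiMap n γ m ≤ PhiMap n β m) :
    EE n n β ≤ EE n n γ := by
  obtain ⟨a, ha, h1, hs⟩ := main_lemma n n β γ hβ hγ hβ0 hγ0
    (fun k hk => absurd k.2 (by omega))
  rw [Finset.sum_range_succ, h1, one_mul] at hs
  have : ∑ m ∈ Finset.range n, a m * (EE n m γ - EE n m β) ≤ 0 := by
    refine Finset.sum_nonpos fun m hm => ?_
    have := h ⟨m, Finset.mem_range.1 hm⟩
    rw [phi_eq, phi_eq] at this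
    exact mul_nonpos_of_nonneg_of_nonpos (ha m) (by simpa using this)
  linarith

theorem EE_cont (n m : ℕ) : Continuous (EE n m) := by
  unfold EE; fun_prop

theorem cont_part (n : ℕ) (hn : 1 ≤ n) (C : (Fin n → ℝ) → ℝ)
    (hC : ∀ β ∈ simplexS n, C (PhiMap n β) = EE n n β) :
    ContinuousOn C (PhiMap n '' simplexS n) := by
  intro e he
  obtain ⟨β, hβ, rfl⟩ := he
  obtain ⟨hβa, hβ0⟩ := simplex_sub n β hβ
  rw [ContinuousWithinAt]
  rw [Filter.tendsto_iff_seq_tendsto]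
  intro u hu
  rw [tendsto_nhdsWithin_iff] at hu
  obtain ⟨hu, hmem⟩ := hu
  refine Filter.tendsto_of_subseq_tendsto fun ns hns => ?_
  have hmem' := hns.eventually hmem
  obtain ⟨K, hK⟩ := Filter.eventually_atTop.1 hmem'
  have hK' : ∀ k : ℕ, ∃ γ ∈ simplexS n, PhiMap n γ = u (ns (k + K)) := fun k => hK _ (by omega)
  choose γ hγ hγu using hK'
  have hlim : Filter.Tendsto (fun k => PhiMap n (γ k)) Filter.atTop (nhds (PhiMap n β)) := by
    simp only [hγu]
    exact hu.comp (hns.comp (Filter.tendsto_add_atTop_nat K))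
  have hpn : ∀ γ : Fin n → ℝ, PhiMap n γ ⟨0, hn⟩ = 8 / 3 * ∑ j, γ j ^ 3 := by
    intro γ; simp [PhiMap]; norm_num
  have hbdd : ∃ B : ℝ, ∀ k, PhiMap n (γ k) ⟨0, hn⟩ ≤ B := by
    have := (((continuous_apply (⟨0, hn⟩ : Fin n)).tendsto _).comp hlim).bddAbove_range
    obtain ⟨B, hB⟩ := this
    exact ⟨B, fun k => hB ⟨k, rfl⟩⟩
  obtain ⟨B, hB⟩ := hbdd
  have hB0 : 0 ≤ B := by
    refine le_trans ?_ (hB 0)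
    rw [hpn]
    have := (simplex_sub n _ (hγ 0)).2
    have : 0 ≤ ∑ j, γ 0 j ^ 3 := Finset.sum_nonneg fun j _ => pow_nonneg (this j) 3
    positivity
  have hbox : ∀ k, γ k ∈ Set.Icc (0 : Fin n → ℝ) (fun _ => B + 1) := by
    intro k
    have h0 := (simplex_sub n _ (hγ k)).2
    refine ⟨h0, fun i => ?_⟩
    have h1 := hB k
    rw [hpn] at h1
    have h2 : γ k i ^ 3 ≤ ∑ j, γ k j ^ 3 :=
      Finset.single_le_sum (f := fun j => γ k j ^ 3) (fun j _ => pow_nonneg (h0 j) 3)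
        (Finset.mem_univ i)
    have h3 : γ k i ^ 3 ≤ B := by
      have := pow_nonneg (h0 i) 3
      linarith
    by_contra hcon
    push Not at hcon
    have h4 : (B + 1) ^ 3 ≤ γ k i ^ 3 := pow_le_pow_left₀ (by linarith) hcon.le 3
    nlinarith [pow_nonneg hB0 3, pow_nonneg hB0 2]
  obtain ⟨δ, hδ, φ, hφ, hφt⟩ := isCompact_Icc.tendsto_subseq hbox
  have hδ0 : ∀ i, 0 ≤ δ i := hδ.1
  have hδt : ∀ i, Filter.Tendsto (fun k => γ (φ k) i) Filter.atTop (nhds (δ i)) :=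
    fun i => ((continuous_apply i).tendsto _).comp hφt
  have hδa : Antitone δ := by
    intro i j hij
    exact le_of_tendsto_of_tendsto' (hδt j) (hδt i)
      (fun k => (simplex_sub n _ (hγ (φ k))).1 hij)
  have hΦc : Continuous (PhiMap n) := continuous_pi fun m => EE_cont n m
  have hΦδ : PhiMap n δ = PhiMap n β :=
    tendsto_nhds_unique ((hΦc.tendsto δ).comp hφt) (hlim.comp hφ.tendsto_atTop)
  have hval : EE n n δ = EE n n β :=
    le_antisymm (EE_mono n δ β hδa hβa hδ0 hβ0 (fun m => by rw [hΦδ]))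
      (EE_mono n β δ hβa hδa hβ0 hδ0 (fun m => by rw [hΦδ]))
  refine ⟨fun k => φ k + K, ?_⟩
  have h5 : (fun k => (C ∘ u) (ns (φ k + K))) = fun k => EE n n (γ (φ k)) := by
    funext k
    simp only [Function.comp]
    rw [← hγu, hC _ (hγ _)]
  rw [hC β hβ, ← hval]
  show Filter.Tendsto (fun k => (C ∘ u) (ns (φ k + K))) _ _
  rw [h5]
  exact ((EE_cont n n).tendsto δ).comp hφt

/-- strictly decreasing positive parameters -/
def strictS (n : ℕ) : Set (Fin n → ℝ) :=
  {β | (∀ i, 0 < β i) ∧ ∀ i j : Fin n, i < j → β j < β i}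

theorem strictS_sub (n : ℕ) : strictS n ⊆ simplexS n := by
  rintro β ⟨h1, h2⟩
  exact ⟨n, le_rfl, fun i _ => h1 i, fun i j h _ => h2 i j h, fun i hi => absurd i.2 (by omega)⟩

theorem strictS_open (n : ℕ) : IsOpen (strictS n) := by
  have : strictS n = (⋂ i : Fin n, {β : Fin n → ℝ | 0 < β i}) ∩
      ⋂ i : Fin n, ⋂ j : Fin n, {β : Fin n → ℝ | i < j → β j < β i} := by
    ext β; simp [strictS]
  rw [this]
  refine (isOpen_iInter_of_finite fun i => isOpen_lt continuous_const (continuous_apply i)).inter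
    (isOpen_iInter_of_finite fun i => isOpen_iInter_of_finite fun j => ?_)
  by_cases h : i < j
  · simp only [h, true_imp_iff]
    exact isOpen_lt (continuous_apply j) (continuous_apply i)
  · simp [h]

theorem interior_strict (n : ℕ) (hn : 1 ≤ n) (e : Fin n → ℝ)
    (he : e ∈ interior (PhiMap n '' simplexS n)) : ∃ β ∈ strictS n, PhiMap n β = e := by
  obtain ⟨β, hβ, rfl⟩ := interior_subset he
  refine ⟨β, ?_, rfl⟩
  obtain ⟨hβa, hβ0⟩ := simplex_sub n β hβ
  obtain ⟨N, hN, h1, h2, h3⟩ := hβ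
  rcases hN.eq_or_lt with h | h
  · subst h
    exact ⟨fun i => h1 i i.2, fun i j hij => h2 i j hij j.2⟩
  exfalso
  set l : Fin n := ⟨n - 1, by omega⟩ with hl
  have hc : Continuous (fun ε : ℝ => PhiMap n β - ε • (Pi.single l 1 : Fin n → ℝ)) := by fun_prop
  have hmem : ∀ᶠ ε in nhds (0 : ℝ), PhiMap n β - ε • (Pi.single l 1 : Fin n → ℝ) ∈
      PhiMap n '' simplexS n := by
    refine hc.continuousAt.eventually_mem ?_
    simpa using mem_interior_iff_mem_nhds.1 he
  obtain ⟨ε, hε, hε0⟩ := ((hmem.filter_mono nhdsWithin_le_nhds).and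
    (self_mem_nhdsWithin (s := Set.Ioi (0 : ℝ)))).exists
  obtain ⟨γ, hγ, hγe⟩ := hε
  obtain ⟨hγa, hγ0⟩ := simplex_sub n γ hγ
  obtain ⟨a, ha, ha1, hs⟩ := main_lemma n (n - 1) β γ hβa hγa hβ0 hγ0 (by
    intro k hk
    rw [h3 k (by omega)]; exact hγ0 k)
  have hE : ∀ m : Fin n, EE n m γ - EE n m β = -(ε * (Pi.single l 1 : Fin n → ℝ) m) := by
    intro m
    have := congrFun hγe m
    rw [phi_eq] at this
    rw [this]
    simp [phi_eq]
  rw [Finset.sum_range_succ, ha1, one_mul, Finset.sum_eq_zero] at hs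
  · have := hE l
    simp only [Pi.single_eq_same, hl] at this
    rw [this] at hs
    replace hε0 : 0 < ε := hε0
    linarith
  · intro m hm
    rw [Finset.mem_range] at hm
    have := hE ⟨m, by omega⟩
    rw [Pi.single_eq_of_ne (by simp [hl]; omega)] at this
    rw [this]; simp

/-- derivative of EE -/
noncomputable def dEE (n m : ℕ) (β : Fin n → ℝ) : (Fin n → ℝ) →L[ℝ] ℝ :=
  ∑ j, (8 * β j ^ 2 * (-(4 * β j ^ 2)) ^ m) • ContinuousLinearMap.proj j

theorem EE_hasFDeriv (n m : ℕ) (β : Fin n → ℝ) : HasFDerivAt (EE n m) (dEE n m β) β := by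
  have hfun : EE n m = fun β : Fin n → ℝ => ∑ j,
      ((-1 : ℝ) ^ m * 2 ^ (2 * m + 3) / (2 * m + 3 : ℝ) * β j ^ (2 * m + 3)) := by
    funext β; simp only [EE, Finset.mul_sum]
  rw [hfun, dEE]
  refine HasFDerivAt.fun_sum fun j _ => ?_
  have h := hasDeriv_H (fun i => if i = m then 1 else 0) m (β j)
  simp only [ite_mul, one_mul, zero_mul, Finset.sum_ite_eq', Finset.mem_range,
    Nat.lt_succ_self, if_true] at h
  have hp : HasFDerivAt (fun f : Fin n → ℝ => f j) (ContinuousLinearMap.proj j) β :=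
    hasFDerivAt_apply (𝕜 := ℝ) j β
  exact HasDerivAt.comp_hasFDerivAt (f := fun f : Fin n → ℝ => f j)
    (h₂ := fun b : ℝ => (-1 : ℝ) ^ m * 2 ^ (2 * m + 3) / (2 * m + 3 : ℝ) * b ^ (2 * m + 3)) β h hp

theorem EE_contDiff (n m : ℕ) : ContDiff ℝ 1 (EE n m) := by
  unfold EE; fun_prop

theorem diff_part (n : ℕ) (C : (Fin n → ℝ) → ℝ)
    (hC : ∀ β ∈ simplexS n, C (PhiMap n β) = EE n n β) (β : Fin n → ℝ) (hβ : β ∈ strictS n) :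
    ContDiffAt ℝ 1 C (PhiMap n β) ∧ ∀ j, fderiv ℝ C (PhiMap n β) (Pi.single j 1) < 0 := by
  set A : (Fin n → ℝ) →L[ℝ] (Fin n → ℝ) := ContinuousLinearMap.pi fun m : Fin n => dEE n m β with hA
  have hΦd : HasFDerivAt (PhiMap n) A β := hasFDerivAt_pi.2 fun m => EE_hasFDeriv n m β
  have hΦc : ContDiff ℝ 1 (PhiMap n) := contDiff_pi.2 fun m => EE_contDiff n m
  have hinj : Function.Injective A := by
    rw [injective_iff_map_eq_zero]
    intro v hv
    have hv' : ∀ m : Fin n, ∑ j, (8 * β j ^ 2 * v j) * (-(4 * β j ^ 2)) ^ (m : ℕ) = 0 := by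
      intro m
      have := congrFun hv m
      simp only [hA, ContinuousLinearMap.coe_pi', dEE, sum_apply,
        smul_apply, ContinuousLinearMap.proj_apply, smul_eq_mul,
        Pi.zero_apply] at this
      rw [← this]
      exact Finset.sum_congr rfl fun j _ => by ring
    have hf : Function.Injective (fun j => -(4 * β j ^ 2)) := by
      intro i j hij
      have h1 := hβ.1 i
      have h2 := hβ.1 j
      have h3 : β i = β j := by
        have : β i ^ 2 = β j ^ 2 := by simp at hij; linarith
        exact (pow_left_inj₀ h1.le h2.le two_ne_zero).1 this
      rcases lt_trichotomy i j with h | h | h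
      · have := hβ.2 i j h; linarith
      · exact h
      · have := hβ.2 j i h; linarith
    have := Matrix.eq_zero_of_forall_pow_sum_mul_pow_eq_zero hf hv'
    funext j
    have h1 := congrFun this j
    have h2 := hβ.1 j
    simp only [Pi.zero_apply] at h1
    have h3 : 8 * β j ^ 2 ≠ 0 := by positivity
    exact (mul_eq_zero.1 h1).resolve_left h3
  let A' : (Fin n → ℝ) ≃L[ℝ] (Fin n → ℝ) :=
    (LinearEquiv.ofInjectiveEndo (A : (Fin n → ℝ) →ₗ[ℝ] (Fin n → ℝ)) hinj).toContinuousLinearEquiv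
  have hA' : (A' : (Fin n → ℝ) →L[ℝ] (Fin n → ℝ)) = A := by
    ext v; rfl
  have hΦd' : HasFDerivAt (PhiMap n) (A' : (Fin n → ℝ) →L[ℝ] (Fin n → ℝ)) β := by
    rw [hA']; exact hΦd
  have hΦs : HasStrictFDerivAt (PhiMap n) (A' : (Fin n → ℝ) →L[ℝ] (Fin n → ℝ)) β :=
    hΦc.contDiffAt.hasStrictFDerivAt' hΦd' one_ne_zero
  have hU : strictS n ∈ nhds β := (strictS_open n).mem_nhds hβ
  have hgc := hΦc.contDiffAt.to_localInverse (a := β) hΦd' one_ne_zero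
  set g := hΦc.contDiffAt.localInverse hΦd' one_ne_zero with hg
  have hgβ : g (PhiMap n β) = β := hΦs.localInverse_apply_image
  have hgr : ∀ᶠ y in nhds (PhiMap n β), PhiMap n (g y) = y := hΦs.eventually_right_inverse
  have hgU : ∀ᶠ y in nhds (PhiMap n β), g y ∈ strictS n :=
    hgc.continuousAt.eventually_mem (by rwa [hgβ])
  have hCg : C =ᶠ[nhds (PhiMap n β)] fun y => EE n n (g y) := by
    filter_upwards [hgr, hgU] with y h1 h2
    rw [← hC _ (strictS_sub n h2), h1]
  have hCc : ContDiffAt ℝ 1 C (PhiMap n β) :=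
    ((EE_contDiff n n).contDiffAt.comp _ hgc).congr_of_eventuallyEq hCg
  refine ⟨hCc, ?_⟩
  have hL := (hCc.differentiableAt one_ne_zero).hasFDerivAt
  set L := fderiv ℝ C (PhiMap n β)
  have hchain : L.comp A = dEE n n β := by
    have h1 : HasFDerivAt (fun x => C (PhiMap n x)) (L.comp A) β := hL.comp β hΦd
    have h2 : HasFDerivAt (fun x => C (PhiMap n x)) (dEE n n β) β :=
      (EE_hasFDeriv n n β).congr_of_eventuallyEq (by
        filter_upwards [hU] with x hx using hC x (strictS_sub n hx))
    exact h1.unique h2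
  have hpos : ∀ j, 0 < β j := hβ.1
  obtain ⟨a, -, ha, ha1, -, hax⟩ := poly_exp
    (fun i => if h : i < n then 4 * β ⟨i, h⟩ ^ 2 else 0)
    (by intro i; split_ifs <;> positivity) n
  replace ha := ha (by
    intro i hi
    have := hpos ⟨i, hi⟩
    simp only [hi, dif_pos]; positivity)
  have hroot : ∀ j : Fin n, (-(4 * β j ^ 2)) ^ n =
      - ∑ m : Fin n, a m * (-(4 * β j ^ 2)) ^ (m : ℕ) := by
    intro j
    have := hax (4 * β j ^ 2)
    rw [Finset.prod_eq_zero (Finset.mem_range.2 j.2) (by simp), Finset.sum_range_succ, ha1,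
      Finset.sum_range] at this
    linarith
  have hdn : ∀ v, dEE n n β v = - ∑ m : Fin n, a m * A v m := by
    intro v
    simp only [hA, ContinuousLinearMap.coe_pi', dEE, sum_apply,
        smul_apply, ContinuousLinearMap.proj_apply, smul_eq_mul, hroot,
        Finset.mul_sum]
    rw [Finset.sum_comm, ← Finset.sum_neg_distrib]
    refine Finset.sum_congr rfl fun j _ => ?_
    rw [mul_neg, neg_mul, Finset.mul_sum, Finset.sum_mul]
    congr 1
    exact Finset.sum_congr rfl fun m _ => by ring
  intro j
  obtain ⟨v, hv⟩ : ∃ v, A v = Pi.single j 1 := ⟨A'.symm (Pi.single j 1), by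
    rw [← hA']; exact A'.apply_symm_apply _⟩
  have h1 : L (A v) = dEE n n β v := by rw [← hchain]; rfl
  rw [hdn, hv] at h1
  rw [h1]
  simp only [Pi.single_apply, mul_ite, mul_one, mul_zero, Finset.sum_ite_eq', Finset.mem_univ,
    if_true]
  linarith [ha j j.2.le]

/-- **Properties of the minimal-energy function `C` on `𝓜ⁿ_n = Φ(S)`.**
If `C : ℝⁿ → ℝ` satisfies `C(Φ(β)) = (-1)^n (2^{2n+3}/(2n+3)) ∑_j β_j^{2n+3}` for all
`β` in the simplex, then (i) `C` is continuous on `Φ(S)`; (ii) `C` is decreasing in each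
variable on `Φ(S)`; (iii) `C` is continuously differentiable on the interior of `Φ(S)`
with strictly negative partial derivatives. -/
theorem stmt_4 (n : ℕ) (hn : 1 ≤ n) (C : (Fin n → ℝ) → ℝ)
    (hC : ∀ β ∈ simplexS n, C (PhiMap n β) =
      (-1 : ℝ) ^ n * 2 ^ (2 * n + 3) / (2 * n + 3 : ℝ) * ∑ j, β j ^ (2 * n + 3)) :
    ContinuousOn C (PhiMap n '' simplexS n) ∧
    (∀ e ∈ PhiMap n '' simplexS n, ∀ e' ∈ PhiMap n '' simplexS n,
      (∀ m, e' m ≤ e m) → C e ≤ C e') ∧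
    ContDiffOn ℝ 1 C (interior (PhiMap n '' simplexS n)) ∧
    (∀ e ∈ interior (PhiMap n '' simplexS n), ∀ j : Fin n,
      fderiv ℝ C e (Pi.single j 1) < 0) := by
  
  have hC' : ∀ β ∈ simplexS n, C (PhiMap n β) = EE n n β := hC
  refine ⟨cont_part n hn C hC', ?_, ?_, ?_⟩
  · rintro _ ⟨β, hβ, rfl⟩ _ ⟨γ, hγ, rfl⟩ h
    rw [hC' β hβ, hC' γ hγ]
    exact EE_mono n β γ (simplex_sub n β hβ).1 (simplex_sub n γ hγ).1 (simplex_sub n β hβ).2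
      (simplex_sub n γ hγ).2 h
  · intro e he
    obtain ⟨β, hβ, rfl⟩ := interior_strict n hn e he
    exact (diff_part n C hC' β hβ).1.contDiffWithinAt
  · intro e he j
    obtain ⟨β, hβ, rfl⟩ := interior_strict n hn e he
    exact (diff_part n C hC' β hβ).2 j
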